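/- arXiv:1301.1613 — 5 statements merged into one kernel-verified Lean document; each statement's English description precedes it below -/
import Mathlib

section
/- Let u : ℝ^d → ℝ be three times continuously differentiable with ∇u ℤ^d-periodic, ⟨∇u⟩ ≠ 0, and ∇u(x) ≠ 0 for every x. Let X : ℝ × ℝ^d → ℝ^d be continuously differentiable with X(0,x) = x, ∂X/∂t(t,x) = ∇u(X(t,x)), and X(s,X(t,x)) = X(s+t,x), and let τ : ℝ^d → ℝ be the (unique) hitting time with u(X(τ(x),x)) = 0. Assume there is a constant C > 0 such that |∫₀^{τ(x)} Δu(X(t,x)) dt| ≤ C for every x ∈ ℝ^d. Then there exists a measurable ℤ^d-periodic function σ : ℝ^d → ℝ with e^{−C} ≤ σ(x) ≤ e^{C} for almost every x, such that ∫_{ℝ^d} σ (∇u · ∇φ) dx = 0 for every φ ∈ C_c^∞(ℝ^d). (Theorem 2.4, sufficiency: isotropic realizability in the torus with a bounded periodic conductivity.) -/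
open MeasureTheory
open scoped RealInnerProductSpace
open Filter Topology

section FlowIntegral

variable {E : Type*} [NormedAddCommGroup E]

theorem contDiff_one_intervalIntegral [NormedSpace ℝ E] [ProperSpace E] {G : E → ℝ → ℝ}
    (hG : ContDiff ℝ 1 (Function.uncurry G)) (a b : ℝ) :
    ContDiff ℝ 1 fun x => ∫ s in a..b, G x s := by
  set G' : E → ℝ → E →L[ℝ] ℝ := fun x s =>
    (fderiv ℝ (Function.uncurry G) (x, s)).comp (ContinuousLinearMap.inl ℝ E ℝ)
  have hG'cont : Continuous (Function.uncurry G') := by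
    have : Continuous (fderiv ℝ (Function.uncurry G)) := hG.continuous_fderiv one_ne_zero
    exact this.clm_comp continuous_const
  have hderiv : ∀ x s, HasFDerivAt (fun y => G y s) (G' x s) x := fun x s =>
    HasFDerivAt.comp (g := Function.uncurry G) (f := fun y => (y, s)) x
      (hG.differentiable one_ne_zero (x, s)).hasFDerivAt (hasFDerivAt_prodMk_left x s)
  refine contDiff_one_iff_hasFDerivAt.2
    ⟨fun x => ∫ s in a..b, G' x s, by fun_prop, fun x₀ => ?_⟩
  have hGx : ∀ x, Continuous (G x) := fun x =>
    hG.continuous.comp (by fun_prop : Continuous fun s : ℝ => (x, s))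
  have hG'x : ∀ x, Continuous (G' x) := fun x =>
    hG'cont.comp (by fun_prop : Continuous fun s : ℝ => (x, s))
  obtain ⟨M, hM⟩ := ((isCompact_closedBall x₀ 1).prod
    (isCompact_uIcc (a := a) (b := b))).bddAbove_image hG'cont.norm.continuousOn
  refine intervalIntegral.hasFDerivAt_integral_of_dominated_of_fderiv_le (bound := fun _ => M)
    (Metric.closedBall_mem_nhds x₀ one_pos) (.of_forall fun x => (hGx x).aestronglyMeasurable)
    ((hGx x₀).intervalIntegrable _ _) (hG'x x₀).aestronglyMeasurable
    (.of_forall fun t ht x hx => ?_) intervalIntegrable_const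
    (.of_forall fun t _ x _ => hderiv x t)
  exact hM ⟨(x, t), ⟨hx, Set.uIoc_subset_uIcc ht⟩, rfl⟩

variable [InnerProductSpace ℝ E] [FiniteDimensional ℝ E]

theorem contDiff_gradient {n : WithTop ℕ∞} {u : E → ℝ} (hu : ContDiff ℝ (n + 1) u) :
    ContDiff ℝ n (gradient u) :=
  (InnerProductSpace.toDual ℝ E).symm.toContinuousLinearEquiv.contDiff.comp
    (hu.fderiv_right le_rfl)

theorem HasCompactSupport.gradient {φ : E → ℝ} (hφ : HasCompactSupport φ) :
    HasCompactSupport (gradient φ) :=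
  (hφ.fderiv ℝ).comp_left (g := (InnerProductSpace.toDual ℝ E).symm) (map_zero _)

variable [MeasurableSpace E] [BorelSpace E]

/-- Integration by parts against a divergence-free field. -/
theorem integral_inner_gradient_eq_zero_of_trace_fderiv_eq_zero {V : E → E} (hV : ContDiff ℝ 1 V)
    (hdiv : ∀ x, LinearMap.trace ℝ E (fderiv ℝ V x : E →ₗ[ℝ] E) = 0)
    {φ : E → ℝ} (hφ : ContDiff ℝ 1 φ) (hφc : HasCompactSupport φ) :
    ∫ x, ⟪V x, gradient φ x⟫ = 0 := by
  set b := stdOrthonormalBasis ℝ E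
  have hφ' : Continuous (fderiv ℝ φ) := hφ.continuous_fderiv one_ne_zero
  have hV' : Continuous (fderiv ℝ V) := hV.continuous_fderiv one_ne_zero
  have hVi : ∀ i, ContDiff ℝ 1 fun x => ⟪b i, V x⟫ := fun i => contDiff_const.inner ℝ hV
  have hVi' : ∀ i x v, fderiv ℝ (fun x => ⟪b i, V x⟫) x v = ⟪b i, fderiv ℝ V x v⟫ := fun i x v => by
    rw [fderiv_inner_apply ℝ (by fun_prop) (hV.differentiable one_ne_zero x)]
    simp
  have hint1 : ∀ i, Integrable fun x => ⟪b i, V x⟫ * fderiv ℝ φ x (b i) := fun i =>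
    ((hVi i).continuous.mul (hφ'.clm_apply continuous_const)).integrable_of_hasCompactSupport
      ((hφc.fderiv_apply ℝ (b i)).mul_left)
  have hint2 : ∀ i, Integrable fun x => ⟪b i, fderiv ℝ V x (b i)⟫ * φ x := fun i =>
    ((continuous_const.inner (hV'.clm_apply continuous_const)).mul
      hφ.continuous).integrable_of_hasCompactSupport hφc.mul_left
  calc ∫ x, ⟪V x, gradient φ x⟫ = ∫ x, ∑ i, ⟪b i, V x⟫ * fderiv ℝ φ x (b i) := by
        refine integral_congr_ae (.of_forall fun x => ?_)
        change ⟪V x, gradient φ x⟫ = ∑ i, ⟪b i, V x⟫ * fderiv ℝ φ x (b i)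
        rw [inner_gradient_right, RCLike.conj_to_real]
        conv_lhs => rw [← b.sum_repr' (V x)]
        simp
    _ = ∑ i, ∫ x, ⟪b i, V x⟫ * fderiv ℝ φ x (b i) := integral_finsetSum _ fun i _ => hint1 i
    _ = ∑ i, -∫ x, ⟪b i, fderiv ℝ V x (b i)⟫ * φ x := by
        refine Finset.sum_congr rfl fun i _ => ?_
        simp_rw [← hVi']
        refine integral_mul_fderiv_eq_neg_fderiv_mul_of_integrable ?_ (hint1 i) ?_
          (fun x _ => (hVi i).differentiable one_ne_zero x)
          (fun x _ => hφ.differentiable one_ne_zero x)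
        · simpa only [hVi'] using hint2 i
        · exact ((hVi i).continuous.mul hφ.continuous).integrable_of_hasCompactSupport hφc.mul_left
    _ = -∫ x, ∑ i, ⟪b i, fderiv ℝ V x (b i)⟫ * φ x := by
        rw [integral_finsetSum _ fun i _ => hint2 i, Finset.sum_neg_distrib]
    _ = 0 := by
        have : ∀ x, ∑ i, ⟪b i, fderiv ℝ V x (b i)⟫ * φ x = 0 := fun x => by
          have := hdiv x
          rw [LinearMap.trace_eq_sum_inner _ b] at this
          rw [← Finset.sum_mul]
          simp only [ContinuousLinearMap.coe_coe] at this
          rw [this, zero_mul]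
        simp [this]

omit [FiniteDimensional ℝ E] [MeasurableSpace E] [BorelSpace E] in
theorem contDiff_of_unique_root [CompleteSpace E] {f : E × ℝ → ℝ} (hf : ContDiff ℝ 1 f)
    {τ : E → ℝ} (hτ : ∀ x, f (x, τ x) = 0) (huniq : ∀ x t, f (x, t) = 0 → t = τ x)
    (hderiv : ∀ x, deriv (fun t => f (x, t)) (τ x) ≠ 0) : ContDiff ℝ 1 τ := by
  refine contDiff_iff_contDiffAt.2 fun x => ?_
  have hfx : ContDiffAt ℝ 1 f (x, τ x) := hf.contDiffAt
  have hinv : (fderiv ℝ f (x, τ x) ∘L .inr ℝ E ℝ).IsInvertible := by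
    have hd : HasDerivAt (fun t => f (x, t))
        ((fderiv ℝ f (x, τ x) ∘L .inr ℝ E ℝ) 1) (τ x) :=
      (HasFDerivAt.comp (g := f) (f := fun t => (x, t)) (τ x)
        (hf.differentiable one_ne_zero _).hasFDerivAt (hasFDerivAt_prodMk_right x (τ x))).hasDerivAt
    have hc := hderiv x
    rw [hd.deriv] at hc
    refine ⟨ContinuousLinearEquiv.smulLeft (Units.mk0 _ hc), ?_⟩
    ext
    simp
  refine (hfx.contDiffAt_implicitFunction one_ne_zero hinv).congr_of_eventuallyEq ?_
  filter_upwards [hfx.eventually_apply_implicitFunction one_ne_zero hinv] with y hy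
  exact (huniq y _ (hy.trans (hτ x))).symm

omit [MeasurableSpace E] [BorelSpace E] in
/-- The exponential of the integral of the divergence along the flow of `b`, up to the hitting time
of a hypersurface, is an integrating factor of `b`. -/
theorem trace_fderiv_exp_integral_smul_eq_zero {b : E → E} (hb : ContDiff ℝ 2 b)
    {X : ℝ × E → E} (hX : ContDiff ℝ 1 X) (hX0 : ∀ x, X (0, x) = x)
    (hXt : ∀ t x, HasDerivAt (fun s => X (s, x)) (b (X (t, x))) t)
    (hXadd : ∀ s t x, X (s, X (t, x)) = X (s + t, x))
    {τ : E → ℝ} (hτ : ContDiff ℝ 1 τ) (hτX : ∀ s x, τ (X (s, x)) = τ x - s)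
    {D : E → ℝ} (hD : ∀ x, D x = LinearMap.trace ℝ E (fderiv ℝ b x : E →ₗ[ℝ] E)) :
    ContDiff ℝ 1 (fun x => Real.exp (∫ t in (0:ℝ)..τ x, D (X (t, x)))) ∧
    ∀ x, LinearMap.trace ℝ E (fderiv ℝ
      (fun x => Real.exp (∫ t in (0:ℝ)..τ x, D (X (t, x))) • b x) x : E →ₗ[ℝ] E) = 0 := by
  have hDc : ContDiff ℝ 1 D := by
    have h1 : ContDiff ℝ 1 (fderiv ℝ b) := hb.fderiv_right (by norm_num)
    have h2 : D = fun x => ∑ i, ⟪stdOrthonormalBasis ℝ E i,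
        fderiv ℝ b x (stdOrthonormalBasis ℝ E i)⟫ := by
      ext x
      rw [hD, LinearMap.trace_eq_sum_inner _ (stdOrthonormalBasis ℝ E)]
      rfl
    rw [h2]
    exact ContDiff.sum fun i _ => contDiff_const.inner ℝ (h1.clm_apply contDiff_const)
  set w : E → ℝ := fun x => ∫ t in (0:ℝ)..τ x, D (X (t, x)) with hw
  have hwc : ContDiff ℝ 1 w := by
    have : w = fun x => ∫ s in (0:ℝ)..1, τ x * D (X (τ x * s, x)) := by
      ext x
      rw [intervalIntegral.integral_const_mul,
        intervalIntegral.mul_integral_comp_mul_left (f := fun t => D (X (t, x)))]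
      simp [hw]
    rw [this]
    refine contDiff_one_intervalIntegral ?_ 0 1
    have h1 : ContDiff ℝ 1 fun p : E × ℝ => τ p.1 := hτ.comp contDiff_fst
    exact h1.mul (hDc.comp (hX.comp ((h1.mul contDiff_snd).prodMk contDiff_fst)))
  have hexp : ContDiff ℝ 1 fun x => Real.exp (w x) := hwc.exp
  refine ⟨hexp, fun x => ?_⟩
  have hcont : Continuous fun t => D (X (t, x)) :=
    hDc.continuous.comp (hX.continuous.comp (by fun_prop))
  have hwX : ∀ s, w (X (s, x)) = ∫ t in s..τ x, D (X (t, x)) := fun s => by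
    simp only [hw, hτX, hXadd]
    rw [intervalIntegral.integral_comp_add_right (fun t => D (X (t, x)))]
    simp
  have hderiv1 : HasDerivAt (fun s => w (X (s, x))) (-D x) 0 := by
    simp only [hwX]
    simpa [hX0] using intervalIntegral.integral_hasDerivAt_left (hcont.intervalIntegrable 0 (τ x))
      hcont.aestronglyMeasurable.stronglyMeasurableAtFilter hcont.continuousAt
  have hderiv2 : HasDerivAt (fun s => w (X (s, x))) (fderiv ℝ w x (b x)) 0 := by
    have h1 := hXt 0 x
    have h2 : HasFDerivAt w (fderiv ℝ w (X (0, x))) (X (0, x)) :=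
      (hwc.differentiable one_ne_zero _).hasFDerivAt
    have h3 := h2.comp_hasDerivAt (0 : ℝ) h1
    simp only [hX0] at h3
    exact h3
  have hkey := hderiv2.unique hderiv1
  have hwd : HasFDerivAt w (fderiv ℝ w x) x := (hwc.differentiable one_ne_zero x).hasFDerivAt
  have hbd : HasFDerivAt b (fderiv ℝ b x) x := (hb.differentiable two_ne_zero x).hasFDerivAt
  have hfd : HasFDerivAt (fun y => Real.exp (w y) • b y) _ x := hwd.exp.smul hbd
  rw [hfd.fderiv]
  have htr : LinearMap.trace ℝ E ((Real.exp (w x) • fderiv ℝ w x : E →L[ℝ] ℝ).smulRight (b x) :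
      E →ₗ[ℝ] E) = Real.exp (w x) * fderiv ℝ w x (b x) := by
    simp
  rw [ContinuousLinearMap.toLinearMap_add, map_add, htr, ContinuousLinearMap.toLinearMap_smul,
    map_smul, ← hD, hkey, smul_eq_mul]
  ring

end FlowIntegral

section InvariantMean

theorem abs_sum_sub_sum_le_of_subset {α : Type*} {S S' : Finset α} (h : S' ⊆ S)
    {a : α → ℝ} {M : ℝ} (hM : ∀ j, |a j| ≤ M) :
    |∑ j ∈ S, a j - ∑ j ∈ S', a j| ≤ M * (S.card - S'.card) := by
  classical
  rw [← Finset.sum_sdiff_eq_sub h]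
  refine (Finset.abs_sum_le_sum_abs _ _).trans
    ((Finset.sum_le_card_nsmul _ _ M fun j _ => hM j).trans (le_of_eq ?_))
  rw [Finset.card_sdiff_of_subset h, nsmul_eq_mul, Nat.cast_sub (Finset.card_le_card h), mul_comm]

variable {ι : Type*} [Fintype ι] [DecidableEq ι]

/-- The box `[-n, n)^ι` of integer points. -/
noncomputable def intBox (ι : Type*) [Fintype ι] [DecidableEq ι] (n : ℕ) : Finset (ι → ℤ) :=
  Fintype.piFinset fun _ => Finset.Ico (-(n : ℤ)) n

theorem mem_intBox {n : ℕ} {j : ι → ℤ} : j ∈ intBox ι n ↔ ∀ i, -(n : ℤ) ≤ j i ∧ j i < n := by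
  simp [intBox]

theorem card_intBox (n : ℕ) : (intBox ι n).card = (2 * n) ^ Fintype.card ι := by
  simp only [intBox, Fintype.card_piFinset, Int.card_Ico, Finset.prod_const, Finset.card_univ]
  congr 1
  omega

theorem tendsto_intBox_average_shift_sub {a : (ι → ℤ) → ℝ} {M : ℝ} (hM : ∀ j, |a j| ≤ M)
    (k : ι → ℤ) :
    Tendsto (fun n : ℕ => (∑ j ∈ intBox ι n, a (j + k)) / (intBox ι n).card -
      (∑ j ∈ intBox ι n, a j) / (intBox ι n).card) atTop (𝓝 0) := by
  obtain ⟨K, hK⟩ : ∃ K : ℕ, ∀ i, |k i| ≤ K := by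
    refine ⟨∑ i, (k i).natAbs, fun i => ?_⟩
    rw [Int.abs_eq_natAbs]
    exact_mod_cast Finset.single_le_sum (f := fun i => (k i).natAbs) (fun _ _ => Nat.zero_le _)
      (Finset.mem_univ i)
  have hlim : Tendsto (fun n : ℕ => 2 * M * (1 - (1 - (K : ℝ) / n) ^ Fintype.card ι)) atTop
      (𝓝 0) := by
    have h1 : Tendsto (fun n : ℕ => (K : ℝ) / n) atTop (𝓝 0) :=
      tendsto_const_div_atTop_nhds_zero_nat _
    simpa using (((h1.const_sub 1).pow (Fintype.card ι)).const_sub 1).const_mul (2 * M)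
  refine squeeze_zero_norm' ?_ hlim
  filter_upwards [eventually_ge_atTop (K + 1)] with n hn
  have hn0 : (0 : ℝ) < n := by exact_mod_cast (by omega : 0 < n)
  have hcard : ((intBox ι n).card : ℝ) = (2 * n) ^ Fintype.card ι := by
    rw [card_intBox]; push_cast; rfl
  have hcard' : ((intBox ι (n - K)).card : ℝ) = (2 * (n - K)) ^ Fintype.card ι := by
    rw [card_intBox]; push_cast [Nat.cast_sub (by omega : K ≤ n)]; rfl
  have hpos : (0 : ℝ) < (intBox ι n).card := by rw [hcard]; positivity
  have hsub : intBox ι (n - K) ⊆ intBox ι n := fun j hj => mem_intBox.2 fun i => by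
    have := mem_intBox.1 hj i
    omega
  have hsub' : intBox ι (n - K) ⊆ (intBox ι n).map (addRightEmbedding k) := fun j hj => by
    refine Finset.mem_map.2 ⟨j - k, mem_intBox.2 fun i => ?_, by simp⟩
    have := mem_intBox.1 hj i
    have hk := abs_le.1 (hK i)
    simp only [Pi.sub_apply]
    omega
  have hsum : ∑ j ∈ intBox ι n, a (j + k) = ∑ j ∈ (intBox ι n).map (addRightEmbedding k), a j := by
    simp
  have h1 := abs_sum_sub_sum_le_of_subset hsub hM
  have h2 := abs_sum_sub_sum_le_of_subset hsub' hM
  rw [Finset.card_map, ← hsum] at h2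
  rw [← sub_div, Real.norm_eq_abs, abs_div, Nat.abs_cast, div_le_iff₀ hpos]
  have h3 : (1 - (K : ℝ) / n) ^ Fintype.card ι * (intBox ι n).card = (intBox ι (n - K)).card := by
    rw [hcard, hcard', ← mul_pow]
    congr 1
    field_simp
  calc |∑ j ∈ intBox ι n, a (j + k) - ∑ j ∈ intBox ι n, a j|
      ≤ 2 * (M * ((intBox ι n).card - (intBox ι (n - K)).card)) := by
        rw [abs_le] at h1 h2 ⊢
        constructor <;> linarith [h1.1, h1.2, h2.1, h2.2]
    _ = _ := by rw [← h3]; ring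

/-- Amenability of `ℤ^ι`. -/
theorem exists_invariant_mean (ι : Type*) [Fintype ι] : ∃ L : ((ι → ℤ) → ℝ) → ℝ,
    (∀ (a b : (ι → ℤ) → ℝ) (M N : ℝ), (∀ j, |a j| ≤ M) → (∀ j, |b j| ≤ N) →
      L (fun j => a j + b j) = L a + L b) ∧
    (∀ (c : ℝ) (a : (ι → ℤ) → ℝ) (M : ℝ), (∀ j, |a j| ≤ M) → L (fun j => c * a j) = c * L a) ∧
    (∀ (k : ι → ℤ) (a : (ι → ℤ) → ℝ) (M : ℝ), (∀ j, |a j| ≤ M) → L (fun j => a (j + k)) = L a) ∧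
    ∀ (a : (ι → ℤ) → ℝ) (m M : ℝ), (∀ j, a j ∈ Set.Icc m M) → L a ∈ Set.Icc m M := by
  classical
  set A : ((ι → ℤ) → ℝ) → ℕ → ℝ := fun a n => (∑ j ∈ intBox ι n, a j) / (intBox ι n).card with hA
  set U : Filter ℕ := (hyperfilter ℕ : Filter ℕ)
  have hU : U ≤ atTop := Nat.hyperfilter_le_atTop
  have hmem : ∀ (a : (ι → ℤ) → ℝ) (m M : ℝ), (∀ j, a j ∈ Set.Icc m M) →
      ∀ᶠ n in atTop, A a n ∈ Set.Icc m M := fun a m M h => by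
    filter_upwards [eventually_gt_atTop 0] with n hn
    have hpos : (0 : ℝ) < (intBox ι n).card := by
      rw [card_intBox]; positivity
    rw [hA, Set.mem_Icc, le_div_iff₀ hpos, div_le_iff₀ hpos, mul_comm m, mul_comm M, ← nsmul_eq_mul,
      ← nsmul_eq_mul]
    exact ⟨Finset.card_nsmul_le_sum _ _ _ fun j _ => (h j).1,
      Finset.sum_le_card_nsmul _ _ _ fun j _ => (h j).2⟩
  have hlim : ∀ (a : (ι → ℤ) → ℝ) (m M : ℝ), (∀ j, a j ∈ Set.Icc m M) →
      ∃ l ∈ Set.Icc m M, Tendsto (A a) U (𝓝 l) := fun a m M h => by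
    obtain ⟨l, hl, hle⟩ := isCompact_Icc.ultrafilter_le_nhds ((hyperfilter ℕ).map (A a))
      (le_principal_iff.2 (hU (hmem a m M h)))
    exact ⟨l, hl, hle⟩
  have hbdd : ∀ (a : (ι → ℤ) → ℝ) (M : ℝ), (∀ j, |a j| ≤ M) →
      Tendsto (A a) U (𝓝 (limUnder U (A a))) := fun a M h => by
    obtain ⟨l, -, hl⟩ := hlim a (-M) M fun j => abs_le.1 (h j)
    exact tendsto_nhds_limUnder ⟨l, hl⟩
  refine ⟨fun a => limUnder U (A a), fun a b M N ha hb => ?_, fun c a M ha => ?_,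
    fun k a M ha => ?_, fun a m M h => ?_⟩
  · refine Tendsto.limUnder_eq (((hbdd a M ha).add (hbdd b N hb)).congr fun n => ?_)
    simp only [hA]
    rw [Finset.sum_add_distrib, add_div]
  · refine Tendsto.limUnder_eq (((hbdd a M ha).const_mul c).congr fun n => ?_)
    simp only [hA]
    rw [← Finset.mul_sum, mul_div_assoc]
  · refine Tendsto.limUnder_eq ?_
    simpa [hA] using ((tendsto_intBox_average_shift_sub ha k).mono_left hU).add (hbdd a M ha)
  · obtain ⟨l, hlm, hl⟩ := hlim a m M h
    rwa [← hl.limUnder_eq] at hlm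

end InvariantMean

section Periodization

variable {d : ℕ}

/-- An integer vector, as a point of Euclidean space. -/
noncomputable def intVec (k : Fin d → ℤ) : EuclideanSpace ℝ (Fin d) :=
  (WithLp.equiv 2 (Fin d → ℝ)).symm fun i => (k i : ℝ)

/-- The coordinatewise integer part of a point of Euclidean space. -/
noncomputable def floorVec (x : EuclideanSpace ℝ (Fin d)) : Fin d → ℤ := fun i => ⌊x i⌋

/-- The half-open unit cube. -/
def unitCell (d : ℕ) : Set (EuclideanSpace ℝ (Fin d)) := {x | floorVec x = 0}

@[simp] theorem intVec_apply (k : Fin d → ℤ) (i : Fin d) : intVec k i = k i := rfl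

theorem intVec_add (j k : Fin d → ℤ) : intVec (j + k) = intVec j + intVec k := by
  ext i; simp

theorem floorVec_add_intVec (x : EuclideanSpace ℝ (Fin d)) (k : Fin d → ℤ) :
    floorVec (x + intVec k) = floorVec x + k := by
  ext i; simp [floorVec]

theorem floorVec_sub_intVec (x : EuclideanSpace ℝ (Fin d)) (k : Fin d → ℤ) :
    floorVec (x - intVec k) = floorVec x - k := by
  ext i; simp [floorVec]

theorem measurable_floorVec : Measurable (floorVec (d := d)) :=
  measurable_pi_lambda _ fun i => Int.measurable_floor.comp (by fun_prop)

theorem measurableSet_unitCell : MeasurableSet (unitCell d) :=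
  measurable_floorVec (measurableSet_singleton 0)

theorem volume_unitCell_lt_top : volume (unitCell d) < ⊤ := by
  have hb : Bornology.IsBounded (unitCell d) := by
    refine isBounded_iff_forall_norm_le.2 ⟨√(∑ _i : Fin d, 1 ^ 2), fun x hx => ?_⟩
    rw [EuclideanSpace.norm_eq]
    refine Real.sqrt_le_sqrt (Finset.sum_le_sum fun i _ => ?_)
    have hi : ⌊x i⌋ = 0 := congrFun hx i
    rw [Int.floor_eq_zero_iff] at hi
    gcongr
    rw [Real.norm_eq_abs, abs_of_nonneg hi.1]
    exact hi.2.le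
  exact hb.measure_lt_top

instance : IsFiniteMeasure (volume.restrict (unitCell d)) :=
  ⟨by simpa using volume_unitCell_lt_top⟩

theorem exists_finset_integral_eq_sum_unitCell {K : Set (EuclideanSpace ℝ (Fin d))}
    (hK : Bornology.IsBounded K) : ∃ F : Finset (Fin d → ℤ),
    ∀ f : EuclideanSpace ℝ (Fin d) → ℝ, Integrable f → (∀ x ∉ K, f x = 0) →
      ∫ x, f x = ∑ k ∈ F, ∫ x in unitCell d, f (x + intVec k) := by
  obtain ⟨R, hR⟩ := hK.exists_norm_le
  refine ⟨Fintype.piFinset fun _ => Finset.Icc ⌊-R⌋ ⌊R⌋, fun f hf hfK => ?_⟩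
  set F : Finset (Fin d → ℤ) := Fintype.piFinset fun _ => Finset.Icc ⌊-R⌋ ⌊R⌋
  have hcell : ∀ k : Fin d → ℤ, ∫ x in floorVec ⁻¹' {k}, f x =
      ∫ x in unitCell d, f (x + intVec k) := fun k => by
    rw [← (measurePreserving_add_right volume (intVec k)).setIntegral_preimage_emb
      (measurableEmbedding_addRight (intVec k)) f]
    congr 2
    ext x
    simp [floorVec_add_intVec, unitCell]
  calc ∫ x, f x = ∫ x in ⋃ k ∈ F, floorVec ⁻¹' {k}, f x := by
        refine (setIntegral_eq_integral_of_forall_compl_eq_zero fun x hx =>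
          hfK x fun hxK => hx ?_).symm
        refine Set.mem_biUnion (x := floorVec x) (Fintype.mem_piFinset.2 fun i => ?_) rfl
        have hi := abs_le.1 ((PiLp.norm_apply_le x i).trans (hR x hxK))
        exact Finset.mem_Icc.2 ⟨Int.floor_le_floor hi.1, Int.floor_le_floor hi.2⟩
    _ = ∑ k ∈ F, ∫ x in floorVec ⁻¹' {k}, f x :=
        integral_biUnion_finset F (fun k _ => measurable_floorVec (measurableSet_singleton k))
          (fun j _ k _ hjk => (Set.disjoint_singleton.2 hjk).preimage _)
          fun k _ => hf.integrableOn
    _ = _ := Finset.sum_congr rfl fun k _ => hcell k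

theorem exists_weak_mean_translates {s : EuclideanSpace ℝ (Fin d) → ℝ} (hs : Measurable s)
    {a b : ℝ} (hab : ∀ x, s x ∈ Set.Icc a b)
    {L : ((Fin d → ℤ) → ℝ) → ℝ}
    (hadd : ∀ (a b : (Fin d → ℤ) → ℝ) (M N : ℝ), (∀ j, |a j| ≤ M) → (∀ j, |b j| ≤ N) →
      L (fun j => a j + b j) = L a + L b)
    (hsmul : ∀ (c : ℝ) (a : (Fin d → ℤ) → ℝ) (M : ℝ), (∀ j, |a j| ≤ M) →
      L (fun j => c * a j) = c * L a)
    (hIcc : ∀ (a : (Fin d → ℤ) → ℝ) (m M : ℝ), (∀ j, a j ∈ Set.Icc m M) → L a ∈ Set.Icc m M) :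
    ∃ m : EuclideanSpace ℝ (Fin d) → ℝ, Measurable m ∧
      (∀ᵐ x ∂volume.restrict (unitCell d), m x ∈ Set.Icc a b) ∧
      ∀ g : EuclideanSpace ℝ (Fin d) → ℝ, MemLp g 2 (volume.restrict (unitCell d)) →
        ∃ M, (∀ j, |∫ x in unitCell d, s (x + intVec j) * g x| ≤ M) ∧
        ∫ x in unitCell d, m x * g x = L fun j => ∫ x in unitCell d, s (x + intVec j) * g x := by
  set μ : Measure (EuclideanSpace ℝ (Fin d)) := volume.restrict (unitCell d)
  have hsM : ∀ x, ‖s x‖ ≤ max |a| |b| := fun x => abs_le_max_abs_abs (hab x).1 (hab x).2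
  have hsj : ∀ j : Fin d → ℤ, Measurable fun x => s (x + intVec j) := fun j =>
    hs.comp (measurable_add_const _)
  have hmem : ∀ j : Fin d → ℤ, MemLp (fun x => s (x + intVec j)) 2 μ := fun j =>
    MemLp.of_bound (hsj j).aestronglyMeasurable _ (.of_forall fun x => hsM _)
  set S : (Fin d → ℤ) → Lp ℝ 2 μ := fun j => (hmem j).toLp
  obtain ⟨B, hB⟩ : ∃ B, ∀ j, ‖S j‖ ≤ B :=
    ⟨_, fun j => Lp.norm_le_of_ae_bound (C := max |a| |b|) (le_max_of_le_left (abs_nonneg a)) (by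
      filter_upwards [(hmem j).coeFn_toLp] with x hx
      rw [hx]
      exact hsM _)⟩
  have hbd : ∀ (g : Lp ℝ 2 μ) (j : Fin d → ℤ), |⟪S j, g⟫| ≤ B * ‖g‖ := fun g j =>
    (abs_real_inner_le_norm _ _).trans (by gcongr; exact hB j)
  let Λ : Lp ℝ 2 μ →L[ℝ] ℝ := LinearMap.mkContinuous
    { toFun := fun g => L fun j => ⟪S j, g⟫
      map_add' := fun g h => by
        simp only [inner_add_right]
        exact hadd _ _ _ _ (hbd g) (hbd h)
      map_smul' := fun c g => by
        simp only [inner_smul_right, RingHom.id_apply, smul_eq_mul]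
        exact hsmul c _ _ (hbd g) } B
    fun g => abs_le.2 (hIcc _ _ _ fun j => abs_le.1 (hbd g j))
  set m : Lp ℝ 2 μ := (InnerProductSpace.toDual ℝ (Lp ℝ 2 μ)).symm Λ
  have hinner : ∀ {f g : EuclideanSpace ℝ (Fin d) → ℝ} {f' : Lp ℝ 2 μ} (_ : f' =ᵐ[μ] f)
      (hg : MemLp g 2 μ), ⟪f', hg.toLp⟫ = ∫ x, f x * g x ∂μ := fun {f g f'} hf hg => by
    rw [L2.inner_def]
    refine integral_congr_ae ?_
    filter_upwards [hf, hg.coeFn_toLp] with x h1 h2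
    rw [h1, h2]
    simp [mul_comm]
  have hkey : ∀ {g : EuclideanSpace ℝ (Fin d) → ℝ} (_ : MemLp g 2 μ),
      ∫ x, m x * g x ∂μ = L fun j => ∫ x, s (x + intVec j) * g x ∂μ := fun {g} hg => by
    rw [← hinner (ae_eq_refl _) hg, InnerProductSpace.toDual_symm_apply]
    change (L fun j => ⟪S j, hg.toLp⟫) = _
    simp only [S, hinner (hmem _).coeFn_toLp hg]
  have hset : ∀ A, MeasurableSet A →
      ∫ x in A, m x ∂μ ∈ Set.Icc (∫ _ in A, a ∂μ) (∫ _ in A, b ∂μ) := by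
    intro A hA
    have hind : ∀ f : EuclideanSpace ℝ (Fin d) → ℝ,
        ∫ x in A, f x ∂μ = ∫ x, f x * A.indicator (fun _ => 1) x ∂μ := fun f => by
      rw [← integral_indicator hA]
      congr 1 with x
      by_cases hx : x ∈ A <;> simp [hx]
    have hgA : MemLp (A.indicator fun _ => (1 : ℝ)) 2 μ :=
      memLp_indicator_const 2 hA 1 (.inr (measure_ne_top _ _))
    rw [hind m, hkey hgA]
    refine hIcc _ _ _ fun j => ?_
    rw [← hind fun x => s (x + intVec j)]
    have hi : IntegrableOn (fun x => s (x + intVec j)) A μ :=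
      ((hmem j).integrable one_le_two).integrableOn
    exact ⟨integral_mono (integrable_const _) hi fun x => (hab _).1,
      integral_mono hi (integrable_const _) fun x => (hab _).2⟩
  have hmi : Integrable m μ := (Lp.memLp m).integrable one_le_two
  refine ⟨m, (Lp.stronglyMeasurable m).measurable, ?_, fun g hg => ⟨B * ‖hg.toLp‖, fun j => ?_,
    hkey hg⟩⟩
  · filter_upwards [ae_le_of_forall_setIntegral_le (integrable_const a) hmi
      fun A hA _ => (hset A hA).1, ae_le_of_forall_setIntegral_le hmi (integrable_const b)
      fun A hA _ => (hset A hA).2] with x h1 h2 using ⟨h1, h2⟩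
  · rw [← hinner (hmem j).coeFn_toLp hg]
    exact hbd _ j

/-- Averaging over integer translates: a bounded function whose translates all annihilate `h` can be
replaced by a periodic one with the same bounds annihilating `h`. -/
theorem exists_periodic_forall_integral_eq_zero {s : EuclideanSpace ℝ (Fin d) → ℝ}
    (hs : Measurable s) {a b : ℝ} (hab : ∀ x, s x ∈ Set.Icc a b) :
    ∃ σ : EuclideanSpace ℝ (Fin d) → ℝ, Measurable σ ∧
      (∀ x (k : Fin d → ℤ), σ (x + intVec k) = σ x) ∧ (∀ᵐ x, σ x ∈ Set.Icc a b) ∧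
      ∀ h : EuclideanSpace ℝ (Fin d) → ℝ, Continuous h → HasCompactSupport h →
        (∀ j, ∫ x, s (x + intVec j) * h x = 0) → ∫ x, σ x * h x = 0 := by
  obtain ⟨L, hadd, hsmul, hshift, hIcc⟩ := exists_invariant_mean (Fin d)
  obtain ⟨m, hm, hmab, hmL⟩ := exists_weak_mean_translates hs hab hadd hsmul hIcc
  have hσm : Measurable fun x => m (x - intVec (floorVec x)) :=
    hm.comp (measurable_id.sub ((measurable_of_countable intVec).comp measurable_floorVec))
  have hσab : ∀ᵐ x, m (x - intVec (floorVec x)) ∈ Set.Icc a b := by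
    rw [ae_restrict_iff' measurableSet_unitCell] at hmab
    have h1 : ∀ k : Fin d → ℤ, ∀ᵐ x : EuclideanSpace ℝ (Fin d), x - intVec k ∈ unitCell d →
        m (x - intVec k) ∈ Set.Icc a b := fun k =>
      (measurePreserving_sub_right volume (intVec k)).quasiMeasurePreserving.ae hmab
    filter_upwards [ae_all_iff.2 h1] with x hx
    exact hx _ (by simp [unitCell, floorVec_sub_intVec])
  refine ⟨fun x => m (x - intVec (floorVec x)), hσm, fun x k => ?_, hσab, fun h hc hcs hz => ?_⟩
  · simp [floorVec_add_intVec, intVec_add]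
  have hmul : ∀ {f : EuclideanSpace ℝ (Fin d) → ℝ}, Measurable f → (∀ᵐ x, f x ∈ Set.Icc a b) →
      Integrable fun x => f x * h x := fun {f} hf hfab =>
    (hc.integrable_of_hasCompactSupport hcs).bdd_mul (c := max |a| |b|) hf.aestronglyMeasurable
      (hfab.mono fun x hx => abs_le_max_abs_abs hx.1 hx.2)
  obtain ⟨F, hF⟩ : ∃ F : Finset (Fin d → ℤ), ∀ {f : EuclideanSpace ℝ (Fin d) → ℝ}, Measurable f →
      (∀ᵐ x, f x ∈ Set.Icc a b) → ∫ x, f x * h x =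
        ∑ k ∈ F, ∫ x in unitCell d, f (x + intVec k) * h (x + intVec k) := by
    obtain ⟨F, hF⟩ := exists_finset_integral_eq_sum_unitCell hcs.isCompact.isBounded
    exact ⟨F, fun hf hfab => hF _ (hmul hf hfab) fun x hx => by
      rw [image_eq_zero_of_notMem_tsupport hx, mul_zero]⟩
  have hhk : ∀ k : Fin d → ℤ, MemLp (fun x => h (x + intVec k)) 2 (volume.restrict (unitCell d)) :=
    fun k => by
      obtain ⟨M, hM⟩ := hcs.exists_bound_of_continuous hc
      exact MemLp.of_bound (hc.comp (by fun_prop)).aestronglyMeasurable M (.of_forall fun x => hM _)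
  choose M hM hmean using fun k => hmL _ (hhk k)
  have hsumL : ∀ G : Finset (Fin d → ℤ),
      (∃ N, ∀ j, |∑ k ∈ G, ∫ x in unitCell d, s (x + intVec (j + k)) * h (x + intVec k)| ≤ N) ∧
      ∑ k ∈ G, (L fun j => ∫ x in unitCell d, s (x + intVec (j + k)) * h (x + intVec k)) =
        L fun j => ∑ k ∈ G, ∫ x in unitCell d, s (x + intVec (j + k)) * h (x + intVec k) := by
    intro G
    induction G using Finset.induction_on with
    | empty =>
      have := hIcc (fun _ => 0) 0 0 (by simp)
      simp only [Set.Icc_self, Set.mem_singleton_iff] at this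
      exact ⟨⟨0, by simp⟩, by simp [this]⟩
    | insert k G hk ih =>
      obtain ⟨⟨N, hN⟩, ih⟩ := ih
      simp only [Finset.sum_insert hk]
      refine ⟨⟨M k + N, fun j => (abs_add_le _ _).trans (add_le_add (hM k (j + k)) (hN j))⟩, ?_⟩
      rw [ih, ← hadd _ _ (M k) N (fun j => hM k (j + k)) hN]
  calc ∫ x, m (x - intVec (floorVec x)) * h x
      = ∑ k ∈ F, ∫ x in unitCell d, m x * h (x + intVec k) := by
        rw [hF hσm hσab]
        refine Finset.sum_congr rfl fun k _ =>
          setIntegral_congr_fun measurableSet_unitCell fun x hx => ?_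
        have hx0 : floorVec x = 0 := hx
        simp [floorVec_add_intVec, hx0]
    _ = ∑ k ∈ F, L fun j => ∫ x in unitCell d, s (x + intVec (j + k)) * h (x + intVec k) :=
        Finset.sum_congr rfl fun k _ => by
          rw [hmean k, ← hshift k _ (M k) (hM k)]
    _ = L fun j => ∑ k ∈ F, ∫ x in unitCell d, s (x + intVec (j + k)) * h (x + intVec k) :=
        (hsumL F).2
    _ = L fun _ => 0 := by
        congr 1 with j
        have hj : Measurable fun x => s (x + intVec j) := hs.comp (measurable_add_const _)
        rw [← hz j, hF hj (.of_forall fun x => hab _)]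
        refine Finset.sum_congr rfl fun k _ => ?_
        simp only [intVec_add, add_assoc, add_comm (intVec j)]
    _ = 0 := by simpa using hIcc (fun _ => 0) 0 0 (by simp)

end Periodization

/-- **Theorem 2.4** (sufficiency: isotropic realizability in the torus): if the integral of
`Δu` along the gradient flow up to the hitting time `τ(x)` of `{u = 0}` is uniformly bounded
by `C`, then `∇u` is isotropically realizable with a measurable `ℤ^d`-periodic conductivity
`σ` satisfying `e^{-C} ≤ σ ≤ e^C` almost everywhere. -/
theorem torus_isotropic_realizability_of_bounded (d : ℕ)
    (u : EuclideanSpace ℝ (Fin d) → ℝ) (hu : ContDiff ℝ 3 u)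
    (hper : ∀ (x : EuclideanSpace ℝ (Fin d)) (k : Fin d → ℤ),
      gradient u (x + (WithLp.equiv 2 (Fin d → ℝ)).symm (fun i => (k i : ℝ))) = gradient u x)
    (havg : (∫ x in {x : EuclideanSpace ℝ (Fin d) | ∀ i, x i ∈ Set.Icc (0:ℝ) 1},
      gradient u x) ≠ 0)
    (hnz : ∀ x, gradient u x ≠ 0)
    (X : ℝ × EuclideanSpace ℝ (Fin d) → EuclideanSpace ℝ (Fin d))
    (hX : ContDiff ℝ 1 X)
    (hX0 : ∀ x, X (0, x) = x)
    (hXt : ∀ t x, HasDerivAt (fun s => X (s, x)) (gradient u (X (t, x))) t)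
    (hXsemigroup : ∀ s t x, X (s, X (t, x)) = X (s + t, x))
    (τ : EuclideanSpace ℝ (Fin d) → ℝ)
    (hτ : ∀ x, u (X (τ x, x)) = 0)
    (hτuniq : ∀ x t, u (X (t, x)) = 0 → t = τ x)
    (Δu : EuclideanSpace ℝ (Fin d) → ℝ)
    (hΔu : ∀ x, Δu x = LinearMap.trace ℝ (EuclideanSpace ℝ (Fin d))
      (fderiv ℝ (gradient u) x : EuclideanSpace ℝ (Fin d) →ₗ[ℝ] EuclideanSpace ℝ (Fin d)))
    (C : ℝ) (hC : 0 < C)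
    (hbound : ∀ x, |∫ t in (0:ℝ)..(τ x), Δu (X (t, x))| ≤ C) :
    ∃ σ : EuclideanSpace ℝ (Fin d) → ℝ, Measurable σ ∧
      (∀ (x : EuclideanSpace ℝ (Fin d)) (k : Fin d → ℤ),
        σ (x + (WithLp.equiv 2 (Fin d → ℝ)).symm (fun i => (k i : ℝ))) = σ x) ∧
      (∀ᵐ x : EuclideanSpace ℝ (Fin d),
        σ x ∈ Set.Icc (Real.exp (-C)) (Real.exp C)) ∧
      ∀ φ : EuclideanSpace ℝ (Fin d) → ℝ, ContDiff ℝ (⊤ : ℕ∞) φ → HasCompactSupport φ →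
        (∫ x : EuclideanSpace ℝ (Fin d), σ x * ⟪gradient u x, gradient φ x⟫) = 0 := by
  have hb : ContDiff ℝ 2 (gradient u) := contDiff_gradient (hu.of_le (by norm_num))
  have huX : ContDiff ℝ 1 fun p : EuclideanSpace ℝ (Fin d) × ℝ => u (X (p.2, p.1)) :=
    (hu.of_le (by norm_num)).comp (hX.comp (contDiff_snd.prodMk contDiff_fst))
  have hτc : ContDiff ℝ 1 τ := by
    refine contDiff_of_unique_root huX hτ hτuniq fun x => ?_
    have h1 := (hu.differentiable (by norm_num) (X (τ x, x))).hasFDerivAt.comp_hasDerivAt (τ x)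
      (hXt (τ x) x)
    rw [← inner_gradient_left] at h1
    change deriv (u ∘ fun t => X (t, x)) (τ x) ≠ 0
    rw [h1.deriv]
    exact inner_self_ne_zero.2 (hnz _)
  have hτX : ∀ s x, τ (X (s, x)) = τ x - s := fun s x =>
    (hτuniq _ _ (by rw [hXsemigroup, sub_add_cancel, hτ])).symm
  obtain ⟨hs, hdiv⟩ := trace_fderiv_exp_integral_smul_eq_zero hb hX hX0 hXt hXsemigroup hτc hτX hΔu
  obtain ⟨σ, hσm, hσper, hσab, hσ⟩ := exists_periodic_forall_integral_eq_zero
    hs.continuous.measurable (a := Real.exp (-C)) (b := Real.exp C) fun x =>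
      ⟨Real.exp_le_exp.2 (abs_le.1 (hbound x)).1, Real.exp_le_exp.2 (abs_le.1 (hbound x)).2⟩
  refine ⟨σ, hσm, hσper, hσab, fun φ hφ hφc => ?_⟩
  have hφ1 : ContDiff ℝ 1 φ := hφ.of_le (by exact_mod_cast le_top)
  have hφ' : Continuous (gradient φ) := (contDiff_gradient (n := 0) (by simpa using hφ1)).continuous
  refine hσ _ (hb.continuous.inner hφ') (hφc.gradient.mono fun x hx h0 => hx ?_) fun j => ?_
  · simp only at h0 ⊢
    rw [h0, inner_zero_right]
  have hV := hs.smul (hb.of_le one_le_two)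
  have hVj := hV.comp (contDiff_id.add (contDiff_const (c := intVec j)))
  refine Eq.trans (integral_congr_ae (.of_forall fun x => ?_))
    (integral_inner_gradient_eq_zero_of_trace_fderiv_eq_zero hVj (fun x => ?_) hφ1 hφc)
  · have : gradient u (x + intVec j) = gradient u x := hper x j
    simp [this]
  · refine Eq.trans ?_ (hdiv (x + intVec j))
    exact congrArg (fun T : EuclideanSpace ℝ (Fin d) →L[ℝ] EuclideanSpace ℝ (Fin d) =>
      LinearMap.trace ℝ _ (T : EuclideanSpace ℝ (Fin d) →ₗ[ℝ] EuclideanSpace ℝ (Fin d)))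
      (fderiv_comp_add_right (intVec j))
end

section
/- Let u(x₁,x₂) := x₁ − cos(2πx₂) on ℝ², so ∇u(x) = (1, 2π sin(2πx₂)). Define on the strip Ω := ℝ × (−1/2, 1/2) the function σ(x₁,x₂) := (1 + tan²(πx₂)) / (e^{4π²x₁} + e^{−4π²x₁} tan²(πx₂)). Then σ is positive and continuously differentiable on Ω and satisfies div(σ∇u) = ∂₁σ + ∂₂(2π σ sin(2πx₂)) = 0 everywhere in Ω. (Example 2.4: explicit non-periodic isotropic conductivity realizing ∇u.) -/
open Real

theorem exp_mul_cos_sq_add_exp_neg_mul_sin_sq_pos (a y : ℝ) :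
    0 < exp a * cos y ^ 2 + exp (-a) * sin y ^ 2 := by
  rcases eq_or_ne (cos y) 0 with h | h
  · have hs : sin y ^ 2 = 1 := by simp [sin_sq, h]
    rw [hs, h]
    positivity
  · positivity

theorem one_add_tan_sq_div_eq_inv (a : ℝ) {y : ℝ} (hy : cos y ≠ 0) :
    (1 + tan y ^ 2) / (exp a + exp (-a) * tan y ^ 2)
      = (exp a * cos y ^ 2 + exp (-a) * sin y ^ 2)⁻¹ := by
  have hD := exp_mul_cos_sq_add_exp_neg_mul_sin_sq_pos a y
  have hE : 0 < exp a + exp (-a) * tan y ^ 2 := by positivity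
  rw [div_eq_iff hE.ne', eq_inv_mul_iff_mul_eq₀ hD.ne', tan_eq_sin_div_cos]
  field_simp
  rw [cos_sq_add_sin_sq]

theorem cos_pi_mul_ne_zero {y : ℝ} (hy : y ∈ Set.Ioo (-(1/2) : ℝ) (1/2)) :
    cos (π * y) ≠ 0 :=
  (cos_pos_of_mem_Ioo ⟨by nlinarith [pi_pos, hy.1], by nlinarith [pi_pos, hy.2]⟩).ne'

theorem hasDerivAt_conductivity_fst (x θ : ℝ) :
    HasDerivAt (fun t : ℝ =>
        (exp (4*π^2*t) * cos θ ^ 2 + exp (-(4*π^2*t)) * sin θ ^ 2)⁻¹)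
      (-(4*π^2 * (exp (4*π^2*x) * cos θ ^ 2 - exp (-(4*π^2*x)) * sin θ ^ 2))
        / (exp (4*π^2*x) * cos θ ^ 2 + exp (-(4*π^2*x)) * sin θ ^ 2) ^ 2) x := by
  have hl : HasDerivAt (fun t : ℝ => 4*π^2*t) (4*π^2) x := by
    simpa using (hasDerivAt_id x).const_mul (4*π^2)
  refine (((hl.exp.mul_const (cos θ ^ 2)).fun_add (hl.fun_neg.exp.mul_const (sin θ ^ 2))).fun_inv
    (exp_mul_cos_sq_add_exp_neg_mul_sin_sq_pos _ _).ne').congr_deriv ?_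
  ring

theorem hasDerivAt_conductivity_mul_snd (a y : ℝ) :
    HasDerivAt (fun t : ℝ =>
        (exp a * cos (π * t) ^ 2 + exp (-a) * sin (π * t) ^ 2)⁻¹ * (2 * π * sin (2 * π * t)))
      (4*π^2 * (exp a * cos (π * y) ^ 2 - exp (-a) * sin (π * y) ^ 2)
        / (exp a * cos (π * y) ^ 2 + exp (-a) * sin (π * y) ^ 2) ^ 2) y := by
  have hl : HasDerivAt (fun t : ℝ => π * t) π y := by
    simpa using (hasDerivAt_id y).const_mul π
  have hl' : HasDerivAt (fun t : ℝ => 2 * π * t) (2 * π) y := by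
    simpa using (hasDerivAt_id y).const_mul (2 * π)
  have hD := exp_mul_cos_sq_add_exp_neg_mul_sin_sq_pos a (π * y)
  refine (((((hl.cos.fun_pow 2).const_mul (exp a)).fun_add
    ((hl.sin.fun_pow 2).const_mul (exp (-a)))).fun_inv hD.ne').fun_mul
      (hl'.sin.const_mul (2 * π))).congr_deriv ?_
  rw [mul_assoc 2 π y, sin_two_mul, cos_two_mul']
  have h := sin_sq (π * y)
  generalize sin (π * y) = s at *
  generalize cos (π * y) = c at *
  generalize exp a = A at *
  generalize exp (-a) = B at *
  field_simp
  norm_num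
  congr 1
  linear_combination (4 * A * c ^ 2 - 4 * B * s ^ 2) * h

/-- **Example 2.4** (explicit non-periodic isotropic conductivity realizing
`∇u = (1, 2π sin(2πx₂))` for `u(x₁,x₂) = x₁ - cos(2πx₂)`): on the strip
`Ω = ℝ × (-1/2, 1/2)`, the function
`σ(x₁,x₂) = (1 + tan²(πx₂)) / (e^{4π²x₁} + e^{-4π²x₁} tan²(πx₂))` is positive, `C¹`, and
satisfies `div(σ∇u) = ∂₁σ + ∂₂(2π σ sin(2πx₂)) = 0` everywhere in `Ω`. -/
theorem explicit_conductivity_on_strip :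
    (∀ p : ℝ × ℝ, p ∈ Set.univ ×ˢ Set.Ioo (-(1/2) : ℝ) (1/2) →
      0 < (1 + tan (π * p.2) ^ 2)
          / (exp (4*π^2*p.1) + exp (-(4*π^2*p.1)) * tan (π * p.2) ^ 2)) ∧
    ContDiffOn ℝ 1
      (fun p : ℝ × ℝ => (1 + tan (π * p.2) ^ 2)
        / (exp (4*π^2*p.1) + exp (-(4*π^2*p.1)) * tan (π * p.2) ^ 2))
      (Set.univ ×ˢ Set.Ioo (-(1/2) : ℝ) (1/2)) ∧
    ∀ p : ℝ × ℝ, p ∈ Set.univ ×ˢ Set.Ioo (-(1/2) : ℝ) (1/2) →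
      deriv (fun t : ℝ => (1 + tan (π * p.2) ^ 2)
          / (exp (4*π^2*t) + exp (-(4*π^2*t)) * tan (π * p.2) ^ 2)) p.1
      + deriv (fun t : ℝ => ((1 + tan (π * t) ^ 2)
          / (exp (4*π^2*p.1) + exp (-(4*π^2*p.1)) * tan (π * t) ^ 2))
          * (2 * π * Real.sin (2 * π * t))) p.2 = 0 := by
  refine ⟨fun p _ => by positivity, ?_, fun p hp => ?_⟩
  · have h : ContDiff ℝ 1 (fun p : ℝ × ℝ =>
        (exp (4*π^2*p.1) * cos (π * p.2) ^ 2 + exp (-(4*π^2*p.1)) * sin (π * p.2) ^ 2)⁻¹) :=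
      ContDiff.inv (by fun_prop)
        fun p => (exp_mul_cos_sq_add_exp_neg_mul_sin_sq_pos _ _).ne'
    exact h.contDiffOn.congr fun p hp => one_add_tan_sq_div_eq_inv _ (cos_pi_mul_ne_zero hp.2)
  · have h₁ := (hasDerivAt_conductivity_fst p.1 (π * p.2)).congr_of_eventuallyEq
      (.of_forall fun t => one_add_tan_sq_div_eq_inv (4*π^2*t) (cos_pi_mul_ne_zero hp.2))
    have h₂ := (hasDerivAt_conductivity_mul_snd (4*π^2*p.1) p.2).congr_of_eventuallyEq
      (f₁ := fun t : ℝ => ((1 + tan (π * t) ^ 2)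
          / (exp (4*π^2*p.1) + exp (-(4*π^2*p.1)) * tan (π * t) ^ 2))
          * (2 * π * Real.sin (2 * π * t))) <| by
      filter_upwards [isOpen_Ioo.mem_nhds hp.2] with t ht
      rw [one_add_tan_sq_div_eq_inv _ (cos_pi_mul_ne_zero ht)]
    rw [h₁.deriv, h₂.deriv]
    ring
end

section
/- Let u(x₁,x₂) := x₁ − cos(2πx₂) on ℝ² and let X : ℝ × ℝ² → ℝ² satisfy X(0,x) = x and ∂X/∂t(t,x) = ∇u(X(t,x)) = (1, 2π sin(2πX₂(t,x))). Then for every x₁ ∈ ℝ and x = (x₁, 0): X(t,x) = (t + x₁, 0) for all t; the unique τ(x) ∈ ℝ with u(X(τ(x),x)) = 0 is τ(x) = 1 − x₁; and ∫₀^{τ(x)} Δu(X(s,x)) ds = 4π²(1 − x₁). In particular, sup over x ∈ ℝ² of |∫₀^{τ(x)} Δu(X(t,x)) dt| is infinite, i.e. the boundedness condition of Theorem 2.4 fails for u. (Example 2.6: failure of isotropic realizability in the torus.) -/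
open Real MeasureTheory

/-- A solution of `f' = 2π sin(2πf)` starting at the equilibrium `0` is constant. -/
theorem eq_zero_of_hasDerivAt_sin {f : ℝ → ℝ} (h0 : f 0 = 0)
    (hf : ∀ t, HasDerivAt f (2*π*Real.sin (2*π*f t)) t) (t : ℝ) : f t = 0 := by
  have hlip : LipschitzWith (2*π*(2*π)).toNNReal (fun y : ℝ => 2*π*Real.sin (2*π*y)) := by
    refine LipschitzWith.of_dist_le_mul fun a b => ?_
    have hπ : (0:ℝ) ≤ 2*π := by positivity
    rw [Real.coe_toNNReal _ (by positivity), Real.dist_eq, Real.dist_eq, ← mul_sub, abs_mul,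
      abs_of_nonneg hπ, mul_assoc (2*π) (2*π)]
    refine mul_le_mul_of_nonneg_left ?_ hπ
    calc |Real.sin (2*π*a) - Real.sin (2*π*b)| ≤ |2*π*a - 2*π*b| := by
          simpa [Real.dist_eq] using Real.lipschitzWith_sin.dist_le_mul (2*π*a) (2*π*b)
      _ = 2*π*|a - b| := by rw [← mul_sub, abs_mul, abs_of_nonneg hπ]
  have huniq := ODE_solution_unique_univ (v := fun _ y => 2*π*Real.sin (2*π*y))
    (s := fun _ => Set.univ) (t₀ := 0) (f := f) (g := fun _ => 0)
    (fun _ => hlip.lipschitzOnWith) (fun t => ⟨hf t, Set.mem_univ _⟩)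
    (fun t => ⟨by simpa using hasDerivAt_const t (0:ℝ), Set.mem_univ _⟩) h0
  exact congrFun huniq t

/-- **Example 2.6** (failure of isotropic realizability in the torus for
`u(x₁,x₂) = x₁ - cos(2πx₂)`, with `Δu = 4π² cos(2πx₂)`): on the line `{x₂ = 0}` the gradient
flow is `X(t,(x₁,0)) = (t + x₁, 0)`, the hitting time of `{u = 0}` is `τ(x₁,0) = 1 - x₁`,
`∫₀^{τ(x)} Δu(X(s,x)) ds = 4π²(1 - x₁)`, and the boundedness condition of Theorem 2.4
fails. -/
theorem torus_realizability_fails_for_example (X : ℝ × (ℝ × ℝ) → ℝ × ℝ)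
    (hX0 : ∀ x : ℝ × ℝ, X (0, x) = x)
    (hXt : ∀ (t : ℝ) (x : ℝ × ℝ), HasDerivAt (fun s => X (s, x))
      (1, 2*π*Real.sin (2*π*(X (t, x)).2)) t)
    (τ : ℝ × ℝ → ℝ)
    (hτ : ∀ x : ℝ × ℝ, (X (τ x, x)).1 - Real.cos (2*π*(X (τ x, x)).2) = 0) :
    (∀ x₁ t : ℝ, X (t, (x₁, 0)) = (t + x₁, 0)) ∧
    (∀ x₁ : ℝ, τ (x₁, 0) = 1 - x₁) ∧
    (∀ x₁ : ℝ, (∫ s in (0:ℝ)..(τ (x₁, 0)), 4*π^2*Real.cos (2*π*(X (s, (x₁, 0))).2))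
      = 4*π^2*(1 - x₁)) ∧
    ¬ ∃ C : ℝ, ∀ x : ℝ × ℝ,
      |∫ t in (0:ℝ)..(τ x), 4*π^2*Real.cos (2*π*(X (t, x)).2)| ≤ C := by
  have hX : ∀ x₁ t : ℝ, X (t, (x₁, 0)) = (t + x₁, 0) := by
    intro x₁ t
    refine Prod.ext ?_ ?_
    · have hd : ∀ s, HasDerivAt (fun s => (X (s, (x₁, 0))).1 - s) 0 s := fun s => by
        have h₁ : HasDerivAt (fun s => (X (s, (x₁, 0))).1) 1 s := by
          simpa using (hXt s (x₁, 0)).hasFDerivAt.fst.hasDerivAt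
        simpa using h₁.fun_sub (hasDerivAt_id' s)
      have hc := is_const_of_deriv_eq_zero (fun s => (hd s).differentiableAt)
        (fun s => (hd s).deriv) t 0
      simp only [hX0, sub_zero] at hc
      exact sub_eq_iff_eq_add'.mp hc
    · exact eq_zero_of_hasDerivAt_sin (f := fun s => (X (s, (x₁, 0))).2) (by simp [hX0])
        (fun s => by simpa using (hXt s (x₁, 0)).hasFDerivAt.snd.hasDerivAt) t
  have hτ_eq : ∀ x₁ : ℝ, τ (x₁, 0) = 1 - x₁ := by
    intro x₁
    have h := hτ (x₁, 0)
    rw [hX] at h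
    simp only [mul_zero, Real.cos_zero] at h
    linarith
  have hint : ∀ x₁ : ℝ,
      (∫ s in (0:ℝ)..(τ (x₁, 0)), 4*π^2*Real.cos (2*π*(X (s, (x₁, 0))).2))
        = 4*π^2*(1 - x₁) := by
    intro x₁
    simp only [hX, hτ_eq, mul_zero, Real.cos_zero, mul_one, intervalIntegral.integral_const,
      sub_zero, smul_eq_mul]
    ring
  refine ⟨hX, hτ_eq, hint, ?_⟩
  rintro ⟨C, hC⟩
  have h := (le_abs_self _).trans (hC (-|C|, 0))
  rw [hint] at h
  have hπ : (1:ℝ) ≤ 4*π^2 := by nlinarith [Real.pi_gt_three]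
  nlinarith [le_abs_self C, abs_nonneg C]
end

section
/- Let d ≥ 2 and let U = (U₁,…,U_d) : ℝ^d → ℝ^d be twice continuously differentiable with DU ℤ^d-periodic, A := ⟨DU⟩ satisfying det A ≠ 0, and det(A · DU(x)) > 0 for every x ∈ ℝ^d. Define σ(x) := det(A) · Cof(DU(x)) · DU(x)^{−1}. Then σ is a ℤ^d-periodic, continuous, symmetric matrix-valued function with σ(x) positive definite for every x (indeed σ = det(A·DU) (DU^{−1})^T DU^{−1}), σ(x) DU(x) = det(A) Cof(DU(x)), and Div(σDU) = 0 classically in ℝ^d, i.e. for each j = 1,…,d the vector field x ↦ σ(x)∇U_j(x) has zero divergence. (Theorem 3.1(i): realizability of a periodic matrix electric field with positive determinant, via Piola's identity.) -/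
open MeasureTheory Matrix

/-- The matrix-valued electric field `DU(x) = [∂U_j/∂x_i]`, whose `j`-th column is `∇U_j`. -/
noncomputable def matGrad {d : ℕ} (U : EuclideanSpace ℝ (Fin d) → EuclideanSpace ℝ (Fin d))
    (x : EuclideanSpace ℝ (Fin d)) : Matrix (Fin d) (Fin d) ℝ :=
  Matrix.of fun i j => fderiv ℝ (fun y => U y j) x (EuclideanSpace.single i 1)

/-- The cofactor matrix `Cof(M)`, characterized by `Cof(M)ᵀ M = det M • I`. -/
noncomputable def cof {d : ℕ} (M : Matrix (Fin d) (Fin d) ℝ) : Matrix (Fin d) (Fin d) ℝ :=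
  (Matrix.adjugate M)ᵀ

section Jacobi

variable {n E : Type*} [Fintype n] [DecidableEq n] [NormedAddCommGroup E] [NormedSpace ℝ E]

/-- Jacobi's formula for the derivative of a determinant. -/
theorem hasFDerivAt_matrix_det {M : E → Matrix n n ℝ} {M' : n → n → E →L[ℝ] ℝ} {x : E}
    (hM : ∀ i j, HasFDerivAt (fun y => M y i j) (M' i j) x) :
    HasFDerivAt (fun y => (M y).det) (∑ i, ∑ j, (M x).adjugate j i • M' i j) x := by
  let D : ContinuousMultilinearMap ℝ (fun _ : n => n → ℝ) ℝ :=
    ⟨(detRowAlternating (n := n) (R := ℝ)).toMultilinearMap,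
      Continuous.matrix_det (A := fun N : Matrix n n ℝ => N) continuous_id⟩
  have hrows : HasFDerivAt (fun y (i : n) (j : n) => M y i j)
      (ContinuousLinearMap.pi fun i => ContinuousLinearMap.pi fun j => M' i j) x :=
    hasFDerivAt_pi.2 fun i => hasFDerivAt_pi.2 fun j => hM i j
  refine ((D.hasFDerivAt (fun i j => M x i j)).comp x hrows).congr_fderiv ?_
  ext v
  simp only [ContinuousLinearMap.comp_apply, ContinuousMultilinearMap.linearDeriv_apply,
    _root_.sum_apply, _root_.smul_apply, smul_eq_mul]
  refine Finset.sum_congr rfl fun i _ => ?_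
  change ((M x).updateRow i fun j => M' i j v).det = _
  rw [← cramer_transpose_apply, cramer_eq_adjugate_mulVec, ← adjugate_transpose]
  rfl

theorem differentiableAt_matrix_adjugate {M : E → Matrix n n ℝ} {x : E}
    (hM : ∀ i j, DifferentiableAt ℝ (fun y => M y i j) x) (i j : n) :
    DifferentiableAt ℝ (fun y => (M y).adjugate i j) x := by
  simp only [adjugate_apply]
  refine (hasFDerivAt_matrix_det fun k l => DifferentiableAt.hasFDerivAt ?_).differentiableAt
  by_cases h : k = j
  · subst h
    simp
  · simpa [updateRow_ne h] using hM k l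

end Jacobi

section Piola

variable {d : ℕ} {U : EuclideanSpace ℝ (Fin d) → EuclideanSpace ℝ (Fin d)}

theorem contDiff_matGrad_apply (hU : ContDiff ℝ 2 U) (i j : Fin d) :
    ContDiff ℝ 1 fun x => matGrad U x i j := by
  have hj : ContDiff ℝ 2 fun y => U y j := (contDiff_euclidean.1 hU) j
  exact (hj.fderiv_right (m := 1) (by norm_num)).clm_apply contDiff_const

theorem differentiableAt_matGrad_apply (hU : ContDiff ℝ 2 U) (i j : Fin d)
    (x : EuclideanSpace ℝ (Fin d)) : DifferentiableAt ℝ (fun y => matGrad U y i j) x :=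
  (contDiff_matGrad_apply hU i j).differentiable (by norm_num) x

theorem continuous_matGrad (hU : ContDiff ℝ 2 U) : Continuous (matGrad U) :=
  continuous_matrix fun i j => (contDiff_matGrad_apply hU i j).continuous

theorem fderiv_matGrad_comm (hU : ContDiff ℝ 2 U) (x : EuclideanSpace ℝ (Fin d))
    (i j k : Fin d) :
    fderiv ℝ (fun y => matGrad U y k j) x (EuclideanSpace.single i 1) =
      fderiv ℝ (fun y => matGrad U y i j) x (EuclideanSpace.single k 1) := by
  have hj : ContDiff ℝ 2 fun y => U y j := (contDiff_euclidean.1 hU) j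
  have hd : DifferentiableAt ℝ (fderiv ℝ fun y => U y j) x :=
    (hj.fderiv_right (m := 1) (by norm_num)).differentiable (by norm_num) x
  have key : ∀ v w : EuclideanSpace ℝ (Fin d),
      fderiv ℝ (fun y => fderiv ℝ (fun z => U z j) y v) x w =
        fderiv ℝ (fderiv ℝ fun y => U y j) x w v := fun v w => by
    rw [fderiv_clm_apply hd (differentiableAt_const v)]
    simp
  simp only [matGrad, of_apply, key]
  exact (hj.contDiffAt.isSymmSndFDerivAt (by simp)) _ _

/-- Piola's identity: the columns of the cofactor matrix of a gradient are divergence free,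
at points where the gradient is invertible. -/
theorem piola_identity (hU : ContDiff ℝ 2 U) (x : EuclideanSpace ℝ (Fin d))
    (hx : IsUnit (matGrad U x).det) (j : Fin d) :
    ∑ i, fderiv ℝ (fun y => cof (matGrad U y) i j) x (EuclideanSpace.single i 1) = 0 := by
  set P : Fin d → ℝ := fun j =>
    ∑ i, fderiv ℝ (fun y => cof (matGrad U y) i j) x (EuclideanSpace.single i 1) with hP
  suffices h : matGrad U x *ᵥ P = 0 from
    congrFun (mulVec_injective_of_isUnit ((isUnit_iff_isUnit_det _).2 hx)
      (h.trans (mulVec_zero _).symm)) j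
  have hF := fun i j => differentiableAt_matGrad_apply hU i j x
  have hadj := differentiableAt_matrix_adjugate hF
  have hdet := hasFDerivAt_matrix_det fun i j => (hF i j).hasFDerivAt
  ext k
  have hprod : ∀ i, fderiv ℝ (fun y => ∑ l, matGrad U y k l * (matGrad U y).adjugate l i) x
      (EuclideanSpace.single i 1) =
      ∑ l, (matGrad U x k l * fderiv ℝ (fun y => (matGrad U y).adjugate l i) x
          (EuclideanSpace.single i 1) +
        (matGrad U x).adjugate l i *
          fderiv ℝ (fun y => matGrad U y k l) x (EuclideanSpace.single i 1)) := fun i => by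
    rw [fderiv_fun_sum fun l _ => (hF k l).fun_mul (hadj l i), _root_.sum_apply]
    refine Finset.sum_congr rfl fun l _ => ?_
    rw [fderiv_fun_mul (hF k l) (hadj l i)]
    simp
  have hcol : ∀ i, fderiv ℝ (fun y => ∑ l, matGrad U y k l * (matGrad U y).adjugate l i) x
      (EuclideanSpace.single i 1) =
      if k = i then ∑ a, ∑ b, (matGrad U x).adjugate b a *
        fderiv ℝ (fun y => matGrad U y a b) x (EuclideanSpace.single i 1) else 0 := fun i => by
    have hfun : (fun y => ∑ l, matGrad U y k l * (matGrad U y).adjugate l i) =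
        fun y => if k = i then (matGrad U y).det else 0 := by
      ext y
      rw [← mul_apply, mul_adjugate, Matrix.smul_apply, one_apply, smul_eq_mul, mul_ite, mul_one,
        mul_zero]
    rw [hfun]
    split_ifs
    · rw [hdet.fderiv]
      simp [_root_.sum_apply]
    · simp
  have hsum := Finset.sum_congr rfl fun i (_ : i ∈ Finset.univ) => (hprod i).symm.trans (hcol i)
  simp only [Finset.sum_ite_eq, Finset.mem_univ, if_true, Finset.sum_add_distrib,
    fderiv_matGrad_comm hU x _ _ k] at hsum
  rw [Finset.sum_comm] at hsum
  simpa [mulVec, dotProduct, hP, cof, Finset.mul_sum] using hsum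

end Piola

section Conductivity

variable {d : ℕ}

theorem cof_eq_det_smul_inv_transpose {M : Matrix (Fin d) (Fin d) ℝ} (hM : IsUnit M.det) :
    cof M = M.det • (M⁻¹)ᵀ := by
  rw [cof, inv_def, transpose_smul, smul_smul, Ring.mul_inverse_cancel _ hM, one_smul]

theorem det_smul_cof_mul_inv (A : Matrix (Fin d) (Fin d) ℝ) {M : Matrix (Fin d) (Fin d) ℝ}
    (hM : IsUnit M.det) :
    A.det • (cof M * M⁻¹) = (A * M).det • ((M⁻¹)ᵀ * M⁻¹) := by
  rw [cof_eq_det_smul_inv_transpose hM, smul_mul, smul_smul, det_mul]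

theorem det_smul_cof_mul_inv_mul (A : Matrix (Fin d) (Fin d) ℝ) {M : Matrix (Fin d) (Fin d) ℝ}
    (hM : IsUnit M.det) : A.det • (cof M * M⁻¹) * M = A.det • cof M := by
  rw [smul_mul, Matrix.mul_assoc, nonsing_inv_mul _ hM, Matrix.mul_one]

end Conductivity

/-- **Theorem 3.1(i)** (realizability of a periodic matrix electric field with positive
determinant, via Piola's identity): if `U : ℝ^d → ℝ^d` is `C²` with `ℤ^d`-periodic `DU`,
`A = ⟨DU⟩` invertible, and `det(A ⬝ DU(x)) > 0` everywhere, then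
`σ := det A • Cof(DU) DU⁻¹` is a `ℤ^d`-periodic continuous symmetric positive definite matrix
conductivity with `σ DU = det A • Cof(DU)` and `Div(σ DU) = 0` classically. -/
theorem periodic_matrix_field_realizability (d : ℕ) (hd : 2 ≤ d)
    (U : EuclideanSpace ℝ (Fin d) → EuclideanSpace ℝ (Fin d)) (hU : ContDiff ℝ 2 U)
    (hper : ∀ (x : EuclideanSpace ℝ (Fin d)) (k : Fin d → ℤ),
      matGrad U (x + (WithLp.equiv 2 (Fin d → ℝ)).symm (fun i => (k i : ℝ))) = matGrad U x)
    (A : Matrix (Fin d) (Fin d) ℝ)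
    (hA : ∀ i j, A i j = ∫ x in {x : EuclideanSpace ℝ (Fin d) | ∀ i', x i' ∈ Set.Icc (0:ℝ) 1},
      matGrad U x i j)
    (hAdet : A.det ≠ 0)
    (hdet : ∀ x, 0 < (A * matGrad U x).det) :
    (∀ (x : EuclideanSpace ℝ (Fin d)) (k : Fin d → ℤ),
      A.det • (cof (matGrad U (x + (WithLp.equiv 2 (Fin d → ℝ)).symm fun i => (k i : ℝ)))
          * (matGrad U (x + (WithLp.equiv 2 (Fin d → ℝ)).symm fun i => (k i : ℝ)))⁻¹)
        = A.det • (cof (matGrad U x) * (matGrad U x)⁻¹)) ∧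
    (∀ i j, Continuous fun x =>
      (A.det • (cof (matGrad U x) * (matGrad U x)⁻¹)) i j) ∧
    (∀ x, (A.det • (cof (matGrad U x) * (matGrad U x)⁻¹)).IsSymm) ∧
    (∀ x, (A.det • (cof (matGrad U x) * (matGrad U x)⁻¹)).PosDef) ∧
    (∀ x, A.det • (cof (matGrad U x) * (matGrad U x)⁻¹)
      = (A * matGrad U x).det • (((matGrad U x)⁻¹)ᵀ * (matGrad U x)⁻¹)) ∧
    (∀ x, A.det • (cof (matGrad U x) * (matGrad U x)⁻¹) * matGrad U x
      = A.det • cof (matGrad U x)) ∧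
    ∀ (x : EuclideanSpace ℝ (Fin d)) (j : Fin d),
      ∑ i, fderiv ℝ
        (fun y => ((A.det • (cof (matGrad U y) * (matGrad U y)⁻¹)) *ᵥ
          (fun i' => matGrad U y i' j)) i) x (EuclideanSpace.single i 1) = 0 := by
  have hunit : ∀ x, IsUnit (matGrad U x).det := fun x =>
    isUnit_iff_ne_zero.2 (right_ne_zero_of_mul (det_mul A _ ▸ (hdet x).ne'))
  have hform := fun x => det_smul_cof_mul_inv A (hunit x)
  have hmul := fun x => det_smul_cof_mul_inv_mul A (hunit x)
  have hcont := continuous_matGrad hU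
  have hpos : ∀ x, (A.det • (cof (matGrad U x) * (matGrad U x)⁻¹)).PosDef := fun x => by
    rw [hform, ← conjTranspose_eq_transpose_of_trivial]
    refine (PosDef.conjTranspose_mul_self _ (mulVec_injective_of_isUnit ?_)).smul (hdet x)
    rw [isUnit_nonsing_inv_iff, isUnit_iff_isUnit_det]
    exact hunit x
  refine ⟨fun x k => by rw [hper], fun i j => ?_, fun x => ?_, hpos, hform, hmul, fun x j => ?_⟩
  · have hinv : Continuous fun x => (matGrad U x)⁻¹ := by
      simp only [inv_def, Ring.inverse_eq_inv']
      exact (hcont.matrix_det.inv₀ fun x => (hunit x).ne_zero).smul hcont.matrix_adjugate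
    exact ((hcont.matrix_adjugate.matrix_transpose.matrix_mul hinv).const_smul A.det).matrix_elem
      i j
  · exact isHermitian_iff_isSymm.1 (hpos x).isHermitian
  · have hfun : ∀ i, (fun y => ((A.det • (cof (matGrad U y) * (matGrad U y)⁻¹)) *ᵥ
        (fun i' => matGrad U y i' j)) i) = fun y => A.det * cof (matGrad U y) i j := fun i => by
      ext y
      exact congrFun (congrFun (hmul y) i) j
    have hcof : ∀ i, DifferentiableAt ℝ (fun y => cof (matGrad U y) i j) x := fun i =>
      differentiableAt_matrix_adjugate (fun i j => differentiableAt_matGrad_apply hU i j x) j i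
    simp only [hfun, fderiv_const_mul (hcof _), _root_.smul_apply, smul_eq_mul,
      ← Finset.mul_sum, piola_identity hU x (hunit x) j, mul_zero]
end

section
/- Let d ≥ 2 and let U : ℝ^d → ℝ^d be twice continuously differentiable with DU ℤ^d-periodic, det⟨DU⟩ ≠ 0, and det(⟨DU⟩ · DU(x)) > 0 for every x. Let φ : ℝ^d → ℝ be three times continuously differentiable with Hessian ∇²φ(y) positive definite for every y ∈ ℝ^d. Define J(x) := det(⟨DU⟩) · Cof(D(∇φ∘U)(x)) and σ(x) := J(x) · DU(x)^{−1}. Then σ(x) = det(⟨DU⟩ DU(x)) (DU(x)^{−1})^T Cof(∇²φ(U(x))) DU(x)^{−1} is symmetric positive definite at every point, and Div(σDU) = 0 in ℝ^d, i.e. for each j the vector field x ↦ σ(x)∇U_j(x) has zero divergence. (Proposition 3.1: a family of anisotropic conductivities realizing a given matrix electric field.) -/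
open MeasureTheory Matrix

/-- The Hessian matrix `∇²φ(y) = [∂²φ/∂y_i∂y_j]`. -/
noncomputable def hessMat {d : ℕ} (φ : EuclideanSpace ℝ (Fin d) → ℝ)
    (y : EuclideanSpace ℝ (Fin d)) : Matrix (Fin d) (Fin d) ℝ :=
  Matrix.of fun i j =>
    fderiv ℝ (fun z => fderiv ℝ φ z (EuclideanSpace.single j 1)) y (EuclideanSpace.single i 1)

/-- The matrix field `D(∇φ∘U)(x) = [∂_i(∂_jφ ∘ U)]`. -/
noncomputable def matGradComp {d : ℕ} (φ : EuclideanSpace ℝ (Fin d) → ℝ)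
    (U : EuclideanSpace ℝ (Fin d) → EuclideanSpace ℝ (Fin d))
    (x : EuclideanSpace ℝ (Fin d)) : Matrix (Fin d) (Fin d) ℝ :=
  Matrix.of fun i j =>
    fderiv ℝ (fun y => fderiv ℝ φ (U y) (EuclideanSpace.single j 1)) x
      (EuclideanSpace.single i 1)

section RowDerivatives

variable {E : Type*} [NormedAddCommGroup E] [NormedSpace ℝ E]
  {n : Type*} [Fintype n] [DecidableEq n]

/-- The derivative of a determinant is the sum of the determinants in which one row is replaced by
its derivative. -/
theorem fderiv_det_apply_eq_sum_updateRow {F : E → Matrix n n ℝ} {F' : n → E →L[ℝ] (n → ℝ)} {x : E}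
    (hF : ∀ k, HasFDerivAt (fun y => F y k) (F' k) x) (w : E) :
    fderiv ℝ (fun y => (F y).det) x w = ∑ k, ((F x).updateRow k (F' k w)).det := by
  let D : ContinuousMultilinearMap ℝ (fun _ : n => n → ℝ) ℝ :=
    ⟨(detRowAlternating (R := ℝ) (n := n)).toMultilinearMap,
      Continuous.matrix_det (A := fun M : n → n → ℝ => (Matrix.of M)) continuous_id⟩
  have h := (D.hasFDerivAt (F x)).comp x (hasFDerivAt_pi.2 hF)
  have h' : HasFDerivAt (fun y => (F y).det) _ x := h
  rw [h'.fderiv]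
  exact D.linearDeriv_apply (F x) (ContinuousLinearMap.pi F' w)

/-- If `∂_i F_k = ∂_k F_i` for the rows `F_k` of `F`, then the determinants in which the `i`-th row
is replaced by a fixed vector form a divergence-free field. -/
theorem sum_fderiv_det_updateRow_eq_zero {F : E → Matrix n n ℝ}
    {F' : n → E →L[ℝ] (n → ℝ)} {x : E} (hF : ∀ k, HasFDerivAt (fun y => F y k) (F' k) x)
    (e : n → E) (hsymm : ∀ i k, F' k (e i) = F' i (e k)) (v : n → ℝ) :
    ∑ i, fderiv ℝ (fun y => ((F y).updateRow i v).det) x (e i) = 0 := by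
  let T : n → n → ℝ := fun i k =>
    (((F x).updateRow i v).updateRow k (if k = i then 0 else F' k (e i))).det
  have hT : ∀ i, fderiv ℝ (fun y => ((F y).updateRow i v).det) x (e i) = ∑ k, T i k := by
    intro i
    rw [fderiv_det_apply_eq_sum_updateRow (F' := fun k => if k = i then 0 else F' k)]
    · refine Finset.sum_congr rfl fun k _ => ?_
      by_cases h : k = i <;> simp [T, h]
    · intro k
      by_cases h : k = i
      · subst h
        simpa only [updateRow_self, if_true] using hasFDerivAt_const (𝕜 := ℝ) v x
      · have hrow : (fun y => (F y).updateRow i v k) = fun y => F y k :=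
          funext fun y => updateRow_ne h
        simpa only [hrow, if_neg h] using hF k
  have hanti : ∀ i k, T i k = -T k i := by
    intro i k
    by_cases h : k = i
    · subst h
      have : T k k = 0 := det_eq_zero_of_row_eq_zero k (by simp)
      rw [this, neg_zero]
    · have h' : i ≠ k := fun h0 => h h0.symm
      have hswap : ((F x).updateRow i v).updateRow k (F' k (e i))
          = (((F x).updateRow k v).updateRow i (F' i (e k))).submatrix (Equiv.swap i k) id := by
        ext a b
        rcases eq_or_ne a i with rfl | hai
        · simp [Matrix.updateRow_apply, h, h']
        rcases eq_or_ne a k with rfl | hak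
        · simp [Matrix.updateRow_apply, hsymm]
        · simp [Matrix.updateRow_apply, hai, hak, Equiv.swap_apply_of_ne_of_ne hai hak]
      simp only [T, if_neg h, if_neg h', hswap, det_permute, Equiv.Perm.sign_swap h']
      simp
  simp only [hT]
  have hsum : ∑ i, ∑ k, T i k = -∑ i, ∑ k, T i k := by
    conv_lhs => rw [Finset.sum_comm]
    simp only [← Finset.sum_neg_distrib]
    exact Finset.sum_congr rfl fun i _ => Finset.sum_congr rfl fun k _ => hanti k i
  linarith

end RowDerivatives

section

variable {d : ℕ}

theorem cof_mul (M N : Matrix (Fin d) (Fin d) ℝ) : cof (M * N) = cof M * cof N := by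
  simp [cof, adjugate_mul_distrib, transpose_mul]

theorem cof_eq_det_smul {M : Matrix (Fin d) (Fin d) ℝ} (hM : M.det ≠ 0) :
    cof M = M.det • (M⁻¹)ᵀ := by
  rw [cof, Matrix.inv_def, transpose_smul, smul_smul, Ring.inverse_eq_inv', mul_inv_cancel₀ hM,
    one_smul]

theorem cof_posDef {M : Matrix (Fin d) (Fin d) ℝ} (hM : M.PosDef) : (cof M).PosDef := by
  rw [cof_eq_det_smul hM.det_pos.ne']
  exact hM.inv.transpose.smul hM.det_pos

theorem cof_apply (M : Matrix (Fin d) (Fin d) ℝ) (i j : Fin d) :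
    cof M i j = (M.updateRow i (Pi.single j 1)).det := by
  rw [cof, transpose_apply, adjugate_apply]

/-- The matrix chain rule `D(∇φ∘U) = DU · (∇²φ∘U)`. -/
theorem matGradComp_eq_mul {φ : EuclideanSpace ℝ (Fin d) → ℝ}
    {U : EuclideanSpace ℝ (Fin d) → EuclideanSpace ℝ (Fin d)} {x : EuclideanSpace ℝ (Fin d)}
    (hφ : DifferentiableAt ℝ (fderiv ℝ φ) (U x)) (hU : DifferentiableAt ℝ U x) :
    matGradComp φ U x = matGrad U x * hessMat φ (U x) := by
  ext i j
  have hg : DifferentiableAt ℝ (fun z => fderiv ℝ φ z (EuclideanSpace.single j 1)) (U x) :=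
    hφ.clm_apply (differentiableAt_const _)
  have hc : fderiv ℝ (fun y => fderiv ℝ φ (U y) (EuclideanSpace.single j 1)) x
      = (fderiv ℝ (fun z => fderiv ℝ φ z (EuclideanSpace.single j 1)) (U x)).comp
        (fderiv ℝ U x) := fderiv_comp x hg hU
  have hcoord : ∀ k, fderiv ℝ (fun y => U y k) x (EuclideanSpace.single i 1)
      = fderiv ℝ U x (EuclideanSpace.single i 1) k := by
    intro k
    have := ((EuclideanSpace.proj (𝕜 := ℝ) k).hasFDerivAt (x := U x)).comp x hU.hasFDerivAt
    have h' : HasFDerivAt (fun y => U y k) _ x := this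
    rw [h'.fderiv]
    rfl
  simp only [matGradComp, matGrad, hessMat, mul_apply, of_apply, hc, hcoord,
    ContinuousLinearMap.comp_apply]
  generalize fderiv ℝ U x (EuclideanSpace.single i 1) = w
  conv_lhs => rw [← (EuclideanSpace.basisFun (Fin d) ℝ).sum_repr w]
  simp

/-- Piola's identity: the cofactor matrix of a `C²` gradient field is divergence free. -/
theorem sum_fderiv_cof_eq_zero {V : Fin d → EuclideanSpace ℝ (Fin d) → ℝ}
    {x : EuclideanSpace ℝ (Fin d)} (hV : ∀ l, ContDiff ℝ 2 (V l)) (j : Fin d) :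
    ∑ i, fderiv ℝ (fun y => cof (Matrix.of fun a l =>
      fderiv ℝ (V l) y (EuclideanSpace.single a 1)) i j) x (EuclideanSpace.single i 1) = 0 := by
  have hd : ∀ l, DifferentiableAt ℝ (fderiv ℝ (V l)) x := fun l =>
    ((hV l).fderiv_right (m := 1) (by norm_num)).differentiable (by norm_num) x
  simp only [cof_apply]
  refine sum_fderiv_det_updateRow_eq_zero (F' := fun k => ContinuousLinearMap.pi fun l =>
    (fderiv ℝ (fderiv ℝ (V l)) x).flip (EuclideanSpace.single k 1)) ?_ _ ?_ _
  · intro k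
    refine hasFDerivAt_pi.2 fun l => ?_
    simpa using (hd l).hasFDerivAt.clm_apply
      (hasFDerivAt_const (EuclideanSpace.single k (1 : ℝ)) x)
  · intro i k
    ext l
    exact ((hV l).contDiffAt.isSymmSndFDerivAt (by simp)) _ _

end

/-- **Proposition 3.1** (a family of anisotropic conductivities realizing a given matrix
electric field): if `U` is `C²` with `ℤ^d`-periodic `DU`, `det⟨DU⟩ ≠ 0`,
`det(⟨DU⟩ DU(x)) > 0` everywhere, and `φ` is a `C³` convex potential with everywhere positive
definite Hessian, then with `J := det⟨DU⟩ • Cof(D(∇φ∘U))` the matrix field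
`σ := J DU⁻¹ = det(⟨DU⟩ DU) (DU⁻¹)ᵀ Cof(∇²φ∘U) DU⁻¹` is symmetric positive definite at every
point and `Div(σ DU) = 0` classically. -/
theorem anisotropic_family_realizability (d : ℕ) (hd : 2 ≤ d)
    (U : EuclideanSpace ℝ (Fin d) → EuclideanSpace ℝ (Fin d)) (hU : ContDiff ℝ 2 U)
    (hper : ∀ (x : EuclideanSpace ℝ (Fin d)) (k : Fin d → ℤ),
      matGrad U (x + (WithLp.equiv 2 (Fin d → ℝ)).symm (fun i => (k i : ℝ))) = matGrad U x)
    (A : Matrix (Fin d) (Fin d) ℝ)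
    (hA : ∀ i j, A i j = ∫ x in {x : EuclideanSpace ℝ (Fin d) | ∀ i', x i' ∈ Set.Icc (0:ℝ) 1},
      matGrad U x i j)
    (hAdet : A.det ≠ 0)
    (hdet : ∀ x, 0 < (A * matGrad U x).det)
    (φ : EuclideanSpace ℝ (Fin d) → ℝ) (hφ : ContDiff ℝ 3 φ)
    (hφconvex : ConvexOn ℝ Set.univ φ)
    (hφhess : ∀ y, (hessMat φ y).PosDef) :
    (∀ x, A.det • cof (matGradComp φ U x) * (matGrad U x)⁻¹
      = (A * matGrad U x).det •
          (((matGrad U x)⁻¹)ᵀ * cof (hessMat φ (U x)) * (matGrad U x)⁻¹)) ∧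
    (∀ x, (A.det • cof (matGradComp φ U x) * (matGrad U x)⁻¹).IsSymm) ∧
    (∀ x, (A.det • cof (matGradComp φ U x) * (matGrad U x)⁻¹).PosDef) ∧
    ∀ (x : EuclideanSpace ℝ (Fin d)) (j : Fin d),
      ∑ i, fderiv ℝ
        (fun y => ((A.det • cof (matGradComp φ U y) * (matGrad U y)⁻¹) *ᵥ
          (fun i' => matGrad U y i' j)) i) x (EuclideanSpace.single i 1) = 0 := by
  have hB : ∀ x, (matGrad U x).det ≠ 0 := fun x h => by
    have := hdet x
    rw [det_mul, h, mul_zero] at this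
    exact lt_irrefl _ this
  have hφ' : ContDiff ℝ 2 (fderiv ℝ φ) := hφ.fderiv_right (by norm_num)
  have hformula : ∀ x, A.det • cof (matGradComp φ U x) * (matGrad U x)⁻¹
      = (A * matGrad U x).det •
          (((matGrad U x)⁻¹)ᵀ * cof (hessMat φ (U x)) * (matGrad U x)⁻¹) := by
    intro x
    rw [matGradComp_eq_mul (hφ'.differentiable (by norm_num) _)
      (hU.differentiable (by norm_num) x), cof_mul, cof_eq_det_smul (hB x), det_mul]
    simp only [smul_mul_assoc, smul_smul]
  have hpos : ∀ x, (A.det • cof (matGradComp φ U x) * (matGrad U x)⁻¹).PosDef := by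
    intro x
    rw [hformula x, ← conjTranspose_eq_transpose_of_trivial]
    refine PosDef.smul ?_ (hdet x)
    refine (cof_posDef (hφhess (U x))).conjTranspose_mul_mul_same ?_
    exact mulVec_injective_of_isUnit
      ((isUnit_nonsing_inv_iff).2 ((isUnit_iff_isUnit_det _).2 (hB x).isUnit))
  refine ⟨hformula, fun x => ?_, hpos, fun x j => ?_⟩
  · have h := (hpos x).isHermitian
    rwa [IsHermitian, conjTranspose_eq_transpose_of_trivial] at h
  · have hcol : ∀ i, (fun y => ((A.det • cof (matGradComp φ U y) * (matGrad U y)⁻¹) *ᵥ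
        (fun i' => matGrad U y i' j)) i) = A.det • fun y => cof (matGradComp φ U y) i j := by
      intro i
      funext y
      change ((A.det • cof (matGradComp φ U y) * (matGrad U y)⁻¹) * matGrad U y) i j = _
      rw [Matrix.mul_assoc, nonsing_inv_mul _ (hB y).isUnit, Matrix.mul_one]
      rfl
    simp only [hcol, fderiv_const_smul_field, Pi.smul_apply, _root_.smul_apply]
    rw [← Finset.smul_sum]
    have hV : ∀ l : Fin d, ContDiff ℝ 2
        (fun y => fderiv ℝ φ (U y) (EuclideanSpace.single l 1)) := fun l =>
      (hφ'.comp hU).clm_apply contDiff_const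
    exact smul_eq_zero_of_right _ (sum_fderiv_cof_eq_zero hV j)
end
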